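/- arXiv:1005.5659 — 4 statements merged into one kernel-verified Lean document; each statement's English description precedes it below -/
import Mathlib

section
/- Let A = {A_x}_{x∈Ω_A} and B = {B_y}_{y∈Ω_B} be observables on ℂ^d such that B_y² lies in the complex linear span of the effects {B_{y'} : y' ∈ Ω_B} for every y ∈ Ω_B. Then there exists an instrument implementing A that does not disturb B if and only if A_x B_y = B_y A_x for all x ∈ Ω_A and y ∈ Ω_B. -/
open Matrix
open scoped BigOperators ComplexOrder

open scoped MatrixOrder in
/-- If a family of conjugated products `(C i)ᴴ * C i` sums to zero, every `C i` vanishes. -/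
theorem Matrix.eq_zero_of_sum_conjTranspose_mul_self_eq_zero
    {m ι : Type*} [Fintype m] [Fintype ι] {C : ι → Matrix m m ℂ}
    (h : ∑ i, (C i)ᴴ * C i = 0) (i : ι) : C i = 0 := by
  classical
  have hi := (Finset.sum_eq_zero_iff_of_nonneg
    fun j _ => (posSemidef_conjTranspose_mul_self (C j)).nonneg).mp h i (Finset.mem_univ i)
  exact conjTranspose_mul_self_eq_zero.mp hi

/-- If a unital completely positive map fixes a Hermitian matrix and its square, then its Kraus
operators commute with that matrix. -/
theorem Matrix.IsHermitian.commute_kraus_of_fixed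
    {m ι : Type*} [Fintype m] [DecidableEq m] [Fintype ι] {K : ι → Matrix m m ℂ}
    {H : Matrix m m ℂ} (hH : H.IsHermitian)
    (hK : ∑ i, (K i)ᴴ * K i = 1) (hfix : ∑ i, (K i)ᴴ * H * K i = H)
    (hfix_sq : ∑ i, (K i)ᴴ * (H * H) * K i = H * H) (i : ι) : Commute (K i) H := by
  have hcomm : ∑ i, (H * K i - K i * H)ᴴ * (H * K i - K i * H) = 0 := by
    have hterm (i : ι) : (H * K i - K i * H)ᴴ * (H * K i - K i * H) =
        (K i)ᴴ * (H * H) * K i - (K i)ᴴ * H * K i * H - H * ((K i)ᴴ * H * K i)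
          + H * ((K i)ᴴ * K i) * H := by
      simp only [conjTranspose_sub, conjTranspose_mul, hH.eq]
      noncomm_ring
    simp only [hterm, Finset.sum_add_distrib, Finset.sum_sub_distrib, ← Finset.sum_mul,
      ← Finset.mul_sum, hK, hfix, hfix_sq]
    noncomm_ring
  exact (sub_eq_zero.mp (eq_zero_of_sum_conjTranspose_mul_self_eq_zero hcomm i)).symm

/-- A map in Kraus form that fixes every member of a family fixes its linear span. -/
theorem Matrix.sum_kraus_eq_self_of_mem_span
    {m ι κ : Type*} [Fintype m] [Fintype ι] {K : ι → Matrix m m ℂ} {B : κ → Matrix m m ℂ}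
    (hfix : ∀ y, ∑ i, (K i)ᴴ * B y * K i = B y) {X : Matrix m m ℂ}
    (hX : X ∈ Submodule.span ℂ (Set.range B)) : ∑ i, (K i)ᴴ * X * K i = X := by
  induction hX using Submodule.span_induction with
  | mem X hX =>
    obtain ⟨y, rfl⟩ := hX
    exact hfix y
  | zero => simp
  | add X Y _ _ hX hY => simp only [mul_add, add_mul, Finset.sum_add_distrib, hX, hY]
  | smul c X _ hX =>
    simp only [mul_smul_comm, smul_mul_assoc, ← Finset.smul_sum, hX]

open scoped MatrixOrder in
/-- A positive semidefinite matrix has a Hermitian square root that commutes with everything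
commuting with the matrix. -/
theorem Matrix.PosSemidef.exists_isHermitian_sqrt_commute
    {m : Type*} [Fintype m] [DecidableEq m] {A : Matrix m m ℂ} (hA : A.PosSemidef) :
    ∃ S : Matrix m m ℂ, S.IsHermitian ∧ S * S = A ∧ ∀ X, Commute A X → Commute S X := by
  refine ⟨CFC.sqrt A, (CFC.sqrt_nonneg A).posSemidef.isHermitian,
    CFC.sqrt_mul_sqrt_self A hA.nonneg, fun X hX => ?_⟩
  rw [CFC.sqrt_eq_cfc]
  exact hX.cfc_nnreal _

/-- If every squared effect `B y * B y` lies in the linear span of the effects of `B`,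
then `A` can be measured without disturbing `B` if and only if `A` and `B` commute. -/
theorem nondisturbance_iff_commute_of_squares_in_span
    {d : ℕ} {ΩA ΩB : Type*} [Fintype ΩA] [Fintype ΩB]
    (A : ΩA → Matrix (Fin d) (Fin d) ℂ) (B : ΩB → Matrix (Fin d) (Fin d) ℂ)
    (hA : ∀ x, (A x).PosSemidef) (hAsum : ∑ x, A x = 1)
    (hB : ∀ y, (B y).PosSemidef) (hBsum : ∑ y, B y = 1)
    (hsq : ∀ y, B y * B y ∈ Submodule.span ℂ (Set.range B)) :
    (∃ (n : ℕ) (K : ΩA → Fin n → Matrix (Fin d) (Fin d) ℂ),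
        (∀ x, ∑ α, (K x α)ᴴ * K x α = A x) ∧
        (∀ y, ∑ x, ∑ α, (K x α)ᴴ * B y * K x α = B y)) ↔
      ∀ x y, A x * B y = B y * A x := by
  constructor
  · rintro ⟨n, K, hKA, hKB⟩ x y
    have hone : ∑ p : ΩA × Fin n, (K p.1 p.2)ᴴ * K p.1 p.2 = 1 := by
      simp only [Fintype.sum_prod_type, hKA, hAsum]
    have hfix (y : ΩB) : ∑ p : ΩA × Fin n, (K p.1 p.2)ᴴ * B y * K p.1 p.2 = B y := by
      simpa only [Fintype.sum_prod_type] using hKB y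
    have hBy := (hB y).isHermitian
    have hcomm (α : Fin n) : Commute (K x α) (B y) :=
      hBy.commute_kraus_of_fixed hone (hfix y) (sum_kraus_eq_self_of_mem_span hfix (hsq y)) (x, α)
    have hcomm_star (α : Fin n) : Commute (K x α)ᴴ (B y) := by
      have h := congrArg conjTranspose (hcomm α).eq
      simp only [conjTranspose_mul, hBy.eq] at h
      exact h.symm
    rw [← hKA x]
    exact Commute.sum_left _ _ _ fun α _ => (hcomm_star α).mul_left (hcomm α)
  · intro h
    choose S hS_herm hS_sq hS_comm using fun x => (hA x).exists_isHermitian_sqrt_commute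
    refine ⟨1, fun x _ => S x, fun x => by simp [(hS_herm x).eq, hS_sq], fun y => ?_⟩
    have hterm (x : ΩA) : (S x)ᴴ * B y * S x = A x * B y := by
      rw [(hS_herm x).eq, mul_assoc, ← (hS_comm x _ (h x y)).eq, ← mul_assoc, hS_sq]
    simp only [Finset.univ_unique, Finset.sum_singleton, hterm, ← Finset.sum_mul, hAsum, one_mul]
end

section
/- Let {K_j}_{j∈J} be a finite family of operators on ℂ^d with Σ_j K_j* K_j = 1, and let X be a selfadjoint operator such that Σ_j K_j* X K_j = X and Σ_j K_j* X² K_j = X². Then K_j X = X K_j for every j ∈ J. (Proof identity: Σ_j [K_j, X]* [K_j, X] = Φ(X²) + X Φ(1) X − X Φ(X) − Φ(X) X = 0, where Φ(Y) = Σ_j K_j* Y K_j.) -/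
open Matrix
open scoped BigOperators

open scoped ComplexOrder in
/-- If a finite sum of matrices of the form `Aᴴ * A` vanishes, then so does every summand's `A`. -/
theorem Matrix.eq_zero_of_sum_conjTranspose_mul_self_eq_zero_s4
    {m n J : Type*} [Fintype m] [Fintype n] [Fintype J] {A : J → Matrix m n ℂ}
    (h : ∑ j, (A j)ᴴ * A j = 0) (j : J) : A j = 0 := by
  have htr : ∑ i, ((A i)ᴴ * A i).trace = 0 := by
    rw [← trace_sum, h, trace_zero]
  rw [Finset.sum_eq_zero_iff_of_nonneg
    fun i _ => (posSemidef_conjTranspose_mul_self (A i)).trace_nonneg] at htr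
  exact trace_conjTranspose_mul_self_eq_zero_iff.mp (htr j (Finset.mem_univ j))

/-- The sum of `[K j, X]ᴴ * [K j, X]` for selfadjoint `X`, in terms of the map
`Y ↦ ∑ j, (K j)ᴴ * Y * K j`. -/
theorem Matrix.IsHermitian.sum_conjTranspose_commutator_mul_commutator
    {n J : Type*} [Fintype n] [Fintype J] {X : Matrix n n ℂ} (hX : X.IsHermitian)
    (K : J → Matrix n n ℂ) :
    ∑ j, (K j * X - X * K j)ᴴ * (K j * X - X * K j) =
      ∑ j, (K j)ᴴ * (X * X) * K j + X * (∑ j, (K j)ᴴ * K j) * X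
        - X * (∑ j, (K j)ᴴ * X * K j) - (∑ j, (K j)ᴴ * X * K j) * X := by
  simp only [Finset.mul_sum, Finset.sum_mul, ← Finset.sum_add_distrib, ← Finset.sum_sub_distrib]
  refine Finset.sum_congr rfl fun j _ => ?_
  rw [conjTranspose_sub, conjTranspose_mul, conjTranspose_mul, hX.eq]
  noncomm_ring

/-- If a selfadjoint matrix `X` and its square `X²` are both fixed points of the unital
completely positive map `Y ↦ ∑ j, (K j)ᴴ * Y * K j`, then `X` commutes with every `K j`. -/
theorem selfadjoint_fixed_point_with_square_commutes_with_kraus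
    {d : ℕ} {J : Type*} [Fintype J]
    (K : J → Matrix (Fin d) (Fin d) ℂ)
    (hK : ∑ j, (K j)ᴴ * K j = 1)
    (X : Matrix (Fin d) (Fin d) ℂ) (hX : X.IsHermitian)
    (hfix : ∑ j, (K j)ᴴ * X * K j = X)
    (hfixsq : ∑ j, (K j)ᴴ * (X * X) * K j = X * X) :
    ∀ j, K j * X = X * K j := by
  intro j
  refine sub_eq_zero.mp (eq_zero_of_sum_conjTranspose_mul_self_eq_zero_s4
    (A := fun j => K j * X - X * K j) ?_ j)
  rw [hX.sum_conjTranspose_commutator_mul_commutator, hK, hfix, hfixsq]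
  noncomm_ring
end

section
/- Let A = {A_x}_{x∈Ω_A} be an observable on ℂ^d that admits a repeatable instrument, with all effects A_x nonzero. If |Ω_A| ≥ d − 1, then A is commutative, i.e. A_x A_{x'} = A_{x'} A_x for all x, x' ∈ Ω_A. -/
open Matrix
open scoped BigOperators ComplexOrder

/-- In a finite sum of positive semidefinite conjugates that vanishes, each Kraus operator
maps into the kernel of the conjugated matrix. -/
theorem Matrix.PosSemidef.mulVec_mulVec_eq_zero_of_sum_conj_eq_zero {n ι : Type*} [Fintype n]
    [Fintype ι] {A : Matrix n n ℂ} (hA : A.PosSemidef)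
    {K : ι → Matrix n n ℂ} (h : ∑ α, (K α)ᴴ * A * K α = 0) (α : ι) (w : n → ℂ) :
    A *ᵥ (K α *ᵥ w) = 0 := by
  rw [← hA.dotProduct_mulVec_zero_iff]
  have key : ∑ β, star (K β *ᵥ w) ⬝ᵥ (A *ᵥ (K β *ᵥ w)) = 0 := by
    have h2 := congrArg (fun M => star w ⬝ᵥ (M *ᵥ w)) h
    simpa [Matrix.sum_mulVec, dotProduct_sum, star_mulVec, ← mulVec_mulVec, dotProduct_mulVec,
      Matrix.vecMul_vecMul, Matrix.mul_assoc] using h2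
  exact (Finset.sum_eq_zero_iff_of_nonneg
    (fun β _ => hA.dotProduct_mulVec_nonneg (K β *ᵥ w))).1 key α (Finset.mem_univ α)

/-- A traceless Hermitian matrix of rank at most one vanishes. -/
theorem Matrix.IsHermitian.eq_zero_of_rank_le_one_of_trace_eq_zero {n : Type*} [Fintype n]
    [DecidableEq n] {H : Matrix n n ℂ} (hH : H.IsHermitian) (hr : H.rank ≤ 1)
    (ht : H.trace = 0) : H = 0 := by
  rw [hH.rank_eq_card_non_zero_eigs, Fintype.card_le_one_iff] at hr
  have hsum : ∑ i, hH.eigenvalues i = 0 := by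
    rw [hH.trace_eq_sum_eigenvalues] at ht
    exact (RCLike.ofReal_eq_zero (K := ℂ)).1 (by rw [RCLike.ofReal_sum]; exact ht)
  rw [← hH.eigenvalues_eq_zero_iff]
  funext i
  by_contra hi
  refine hi (Eq.trans ?_ hsum)
  refine (Finset.sum_eq_single i (fun j _ hji => ?_) (by simp)).symm
  by_contra hj
  exact hji (congrArg Subtype.val (hr ⟨j, hj⟩ ⟨i, hi⟩))

/-- The commutator of two Hermitian matrices vanishes as soon as it has rank at most one. -/
theorem Matrix.IsHermitian.mul_comm_of_rank_commutator_le_one {n : Type*} [Fintype n]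
    [DecidableEq n] {A B : Matrix n n ℂ} (hA : A.IsHermitian) (hB : B.IsHermitian)
    (hr : (A * B - B * A).rank ≤ 1) : A * B = B * A := by
  have hH : (Complex.I • (A * B - B * A)).IsHermitian := by
    simp only [IsHermitian, conjTranspose_smul, conjTranspose_sub, conjTranspose_mul, hA.eq, hB.eq]
    simp [← smul_neg]
  have h0 := hH.eq_zero_of_rank_le_one_of_trace_eq_zero
    ((rank_smul_of_mem_nonZeroDivisors _
      (mem_nonZeroDivisors_of_ne_zero Complex.I_ne_zero)).trans_le hr)
    (by rw [trace_smul, trace_sub, trace_mul_comm, sub_self, smul_zero])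
  exact sub_eq_zero.1 ((smul_eq_zero.1 h0).resolve_left Complex.I_ne_zero)

/-- A matrix whose kernel contains a linearly independent family has complementary rank. -/
theorem Matrix.rank_add_card_le_of_linearIndependent {n ι : Type*} [Fintype n] [DecidableEq n]
    [Fintype ι] {M : Matrix n n ℂ} {v : ι → n → ℂ} (hv : LinearIndependent ℂ v)
    (h : ∀ i, M *ᵥ v i = 0) : M.rank + Fintype.card ι ≤ Fintype.card n := by
  have hle : Submodule.span ℂ (Set.range v) ≤ LinearMap.ker M.mulVecLin :=
    Submodule.span_le.2 (by rintro _ ⟨i, rfl⟩; exact h i)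
  have hfin := Submodule.finrank_mono hle
  rw [finrank_span_eq_card hv] at hfin
  have hrn := M.mulVecLin.finrank_range_add_finrank_ker
  rw [Module.finrank_fintype_fun_eq_card] at hrn
  unfold Matrix.rank
  omega

/-- If an observable on `ℂ^d` (with nonzero effects) admits a repeatable instrument and
has at least `d - 1` outcomes, then it is commutative. -/
theorem repeatable_card_ge_commutative
    {d : ℕ} {ΩA : Type*} [Fintype ΩA]
    (A : ΩA → Matrix (Fin d) (Fin d) ℂ)
    (hA : ∀ x, (A x).PosSemidef) (hAsum : ∑ x, A x = 1) (hA0 : ∀ x, A x ≠ 0)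
    (hrep : ∃ (n : ℕ) (K : ΩA → Fin n → Matrix (Fin d) (Fin d) ℂ),
      (∀ x, ∑ α, (K x α)ᴴ * K x α = A x) ∧
      (∀ x y, x ≠ y → ∑ α, (K x α)ᴴ * A y * K x α = 0))
    (hcard : d - 1 ≤ Fintype.card ΩA) :
    ∀ x x', A x * A x' = A x' * A x := by
  classical
  obtain ⟨n, K, hK, hKrep⟩ := hrep
  have hvec : ∀ x, ∃ v : Fin d → ℂ, v ≠ 0 ∧ ∀ y, A y *ᵥ v = if y = x then v else 0 := by
    intro x
    obtain ⟨α, hα⟩ : ∃ α, K x α ≠ 0 := by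
      by_contra! h
      exact hA0 x (by simp [← hK x, h])
    obtain ⟨w, hw⟩ : ∃ w, K x α *ᵥ w ≠ 0 := by
      by_contra! h
      exact hα (Matrix.ext_of_mulVec_single fun i => by rw [h, zero_mulVec])
    have hoff : ∀ y, y ≠ x → A y *ᵥ (K x α *ᵥ w) = 0 := fun y hy =>
      (hA y).mulVec_mulVec_eq_zero_of_sum_conj_eq_zero (hKrep x y hy.symm) α w
    refine ⟨K x α *ᵥ w, hw, fun y => ?_⟩
    split_ifs with hy
    · subst hy
      have h1 := congrArg (· *ᵥ (K y α *ᵥ w)) hAsum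
      simp only [Matrix.sum_mulVec, one_mulVec] at h1
      rwa [Finset.sum_eq_single y (fun z _ hz => hoff z hz) (by simp)] at h1
    · exact hoff y hy
  choose v hv0 hv using hvec
  have hli : LinearIndependent ℂ v := by
    rw [Fintype.linearIndependent_iff]
    intro c hc y
    have h1 := congrArg (A y *ᵥ ·) hc
    simp only [mulVec_sum, mulVec_smul, hv, mulVec_zero, smul_ite, smul_zero] at h1
    rw [Finset.sum_ite_eq Finset.univ y, if_pos (Finset.mem_univ y)] at h1
    exact (smul_eq_zero.1 h1).resolve_right (hv0 y)
  intro x x'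
  refine (hA x).isHermitian.mul_comm_of_rank_commutator_le_one (hA x').isHermitian ?_
  have hrank := rank_add_card_le_of_linearIndependent (M := A x * A x' - A x' * A x) hli
    fun y => by
      rw [sub_mulVec, ← mulVec_mulVec, ← mulVec_mulVec, hv, hv]
      split_ifs <;> simp [*]
  rw [Fintype.card_fin] at hrank
  omega
end

section
/- There exist observables A and B on ℂ³ such that some instrument implementing A does not disturb B, while every instrument implementing B disturbs A. Concretely, one may take B to be the two-outcome observable with effects B₁ = diag(1, 0, 1/2), B₂ = diag(0, 1, 1/2), and A the five-outcome observable with effects A_x = K_x K_x* for the explicit 3×3 matrices K₁,…,K₅ given in the paper (e.g. K₁ has rows (√2/2,0,0),(0,0,0),(−1/2,0,0), etc.): the instrument I_x(ρ) = K_x* ρ K_x implements A with Σ_x K_x B_y K_x* = B_y for y = 1,2, while A₁,…,A₅ are linearly independent (so dim span A = 5 ≥ (3−1)² + 1) and A does not commute with B, whence by the dimension criterion no instrument implementing B leaves both effects of A fixed. In particular, the non-disturbance relation between observables is not symmetric. -/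
open Matrix
open scoped BigOperators ComplexOrder

/-- If a completely positive map with Kraus operators `M i` fixes the diagonal matrix unit at `k`,
then every off-diagonal entry in row `k` of every Kraus operator vanishes. -/
lemma kraus_offDiag_eq_zero {ι m : Type*} [Fintype ι] [Fintype m] [DecidableEq m]
    (M : ι → Matrix m m ℂ) (k : m)
    (h : ∑ i, (M i)ᴴ * Matrix.single k k 1 * M i = Matrix.single k k 1)
    {j : m} (hj : j ≠ k) (i : ι) : M i k j = 0 := by
  have h0 := congrFun (congrFun h j) j
  have hterm : ∀ i, ((M i)ᴴ * Matrix.single k k 1 * M i : Matrix m m ℂ) j j = ((‖M i k j‖ ^ 2 : ℝ) : ℂ) := by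
    intro i
    simp [Matrix.mul_apply, Matrix.single_apply, ite_and, ← Complex.conj_mul']
  rw [Matrix.sum_apply, Finset.sum_congr rfl fun i _ => hterm i, ← Complex.ofReal_sum,
    Matrix.single_apply_of_ne _ _ _ _ _ (fun hk => hj hk.1.symm), Complex.ofReal_eq_zero,
    Finset.sum_eq_zero_iff_of_nonneg fun i _ => by positivity] at h0
  simpa using h0 i (Finset.mem_univ i)

/-- Two families of complex numbers that are unit vectors with inner product one are equal. -/
lemma eq_of_sum_star_mul_eq_one {ι : Type*} [Fintype ι] (a b : ι → ℂ)
    (ha : ∑ i, star (a i) * a i = 1) (hb : ∑ i, star (b i) * b i = 1)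
    (hab : ∑ i, star (a i) * b i = 1) : a = b := by
  have hba : ∑ i, star (b i) * a i = 1 := by
    simpa [mul_comm] using congrArg star hab
  have h : star (a - b) ⬝ᵥ (a - b) = 0 := by
    simp only [dotProduct, Pi.star_apply, Pi.sub_apply, star_sub, sub_mul, mul_sub,
      Finset.sum_sub_distrib, ha, hb, hab, hba]
    norm_num
  exact sub_eq_zero.mp (dotProduct_star_self_eq_zero.mp h)

/-- A channel fixing the diagonal matrix units of `ℂ³` and the symmetric coherence between the
levels `0` and `2` has Kraus operators acting on these two levels by a common scalar. -/
lemma kraus_gram_diag_eq {ι : Type*} [Fintype ι] (M : ι → Matrix (Fin 3) (Fin 3) ℂ)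
    (hd : ∀ k, ∑ i, (M i)ᴴ * Matrix.single k k 1 * M i = Matrix.single k k 1)
    (hX : ∑ i, (M i)ᴴ * (Matrix.single 0 2 1 + Matrix.single 2 0 1) * M i =
      Matrix.single 0 2 1 + Matrix.single 2 0 1) (i : ι) :
    ((M i)ᴴ * M i : Matrix (Fin 3) (Fin 3) ℂ) 0 0 =
      ((M i)ᴴ * M i : Matrix (Fin 3) (Fin 3) ℂ) 2 2 := by
  have hz : ∀ k j : Fin 3, j ≠ k → ∀ i, M i k j = 0 := fun k j hj i =>
    kraus_offDiag_eq_zero M k (hd k) hj i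
  have hnorm : ∀ k, ∑ i, star (M i k k) * M i k k = 1 := fun k => by
    have h := congrFun (congrFun (hd k) k) k
    simpa [Matrix.sum_apply, Matrix.mul_apply, Matrix.single_apply, ite_and] using h
  have hcross : ∑ i, star (M i 0 0) * M i 2 2 = 1 := by
    have h := congrFun (congrFun hX 0) 2
    simpa [Matrix.sum_apply, Matrix.mul_apply, Matrix.single_apply, Fin.sum_univ_three,
      hz 0 2 (by decide)] using h
  have he : M i 0 0 = M i 2 2 :=
    congrFun (eq_of_sum_star_mul_eq_one _ _ (hnorm 0) (hnorm 2) hcross) i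
  simp [Matrix.mul_apply, Fin.sum_univ_three, hz 1 0 (by decide), hz 2 0 (by decide),
    hz 0 2 (by decide), hz 1 2 (by decide), he]

/-- Kraus operators of a five-outcome instrument on `ℂ³`, one for each outcome. -/
noncomputable def coherentKraus : Fin 5 → Matrix (Fin 3) (Fin 3) ℂ :=
  ![!![1/2, 0, 1/2; 0, 0, 0; 0, 0, 0],
    !![1/2, 0, -1/2; 0, 1/2, 0; 0, 0, 0],
    !![1/2, 0, 0; 0, 1/2, 0; 0, 0, 0],
    !![1/2, 0, 0; 0, 1/2, 1/2; 0, 0, 0],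
    !![0, 0, 0; 0, 1/2, -1/2; 0, 0, 0]]

/-- The effects of the observable measured by `coherentKraus`. -/
noncomputable def coherentEffect (x : Fin 5) : Matrix (Fin 3) (Fin 3) ℂ :=
  (coherentKraus x)ᴴ * coherentKraus x

/-- The effects of the two-outcome observable `diag(1, 0, 1/2)`, `diag(0, 1, 1/2)`. -/
noncomputable def diagEffect : Fin 2 → Matrix (Fin 3) (Fin 3) ℂ :=
  ![Matrix.diagonal ![1, 0, 1/2], Matrix.diagonal ![0, 1, 1/2]]

lemma sum_coherentEffect : ∑ x, coherentEffect x = 1 := by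
  ext i j
  fin_cases i <;> fin_cases j <;>
    simp [coherentEffect, coherentKraus, Fin.sum_univ_five, Matrix.mul_apply,
      Fin.sum_univ_three, map_ofNat] <;> norm_num

lemma diagEffect_posSemidef (y : Fin 2) : (diagEffect y).PosSemidef := by
  fin_cases y <;> refine Matrix.PosSemidef.diagonal fun i => ?_ <;> fin_cases i <;> simp

lemma sum_diagEffect : ∑ y, diagEffect y = 1 := by
  ext i j
  fin_cases i <;> fin_cases j <;> (simp [diagEffect, Fin.sum_univ_two]; try norm_num)

lemma coherentKraus_fixes_diagEffect (y : Fin 2) :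
    ∑ x, (coherentKraus x)ᴴ * diagEffect y * coherentKraus x = diagEffect y := by
  ext i j
  fin_cases y <;> fin_cases i <;> fin_cases j <;>
    simp [diagEffect, coherentKraus, Fin.sum_univ_five, Matrix.mul_apply,
      Fin.sum_univ_three, map_ofNat] <;> norm_num

lemma sum_smul_coherentEffect (c : Fin 5 → ℂ) :
    ∑ x, c x • coherentEffect x =
      !![(c 0 + c 1 + c 2 + c 3) / 4, 0, (c 0 - c 1) / 4;
        0, (c 1 + c 2 + c 3 + c 4) / 4, (c 3 - c 4) / 4;
        (c 0 - c 1) / 4, (c 3 - c 4) / 4, (c 0 + c 1 + c 3 + c 4) / 4] := by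
  ext i j
  fin_cases i <;> fin_cases j <;>
    simp [coherentEffect, coherentKraus, Fin.sum_univ_five, Matrix.mul_apply,
      Fin.sum_univ_three, map_ofNat] <;> ring

lemma single_diag_mem_span_coherentEffect (k : Fin 3) :
    ∃ c : Fin 5 → ℂ, ∑ x, c x • coherentEffect x = Matrix.single k k 1 := by
  refine ⟨![![2, 2, 2, -2, -2], ![-2, -2, 2, 2, 2], ![1, 1, -3, 1, 1]] k, ?_⟩
  rw [sum_smul_coherentEffect]
  ext i j
  fin_cases k <;> fin_cases i <;> fin_cases j <;> simp <;> norm_num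

lemma coherence_mem_span_coherentEffect :
    ∃ c : Fin 5 → ℂ, ∑ x, c x • coherentEffect x =
      Matrix.single 0 2 1 + Matrix.single 2 0 1 := by
  refine ⟨![1, -3, 1, 1, 1], ?_⟩
  rw [sum_smul_coherentEffect]
  ext i j
  fin_cases i <;> fin_cases j <;> simp <;> norm_num

/-- Non-disturbance is not a symmetric relation: there are a five-outcome observable `A`
and a two-outcome observable `B` on `ℂ³` such that some instrument implementing `A`
does not disturb `B`, while no instrument implementing `B` leaves all effects of `A`
fixed, i.e. every `B`-measurement disturbs `A`. -/
theorem nondisturbance_not_symmetric :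
    ∃ (A : Fin 5 → Matrix (Fin 3) (Fin 3) ℂ) (B : Fin 2 → Matrix (Fin 3) (Fin 3) ℂ),
      (∀ x, (A x).PosSemidef) ∧ (∑ x, A x = 1) ∧
      (∀ y, (B y).PosSemidef) ∧ (∑ y, B y = 1) ∧
      (∃ (n : ℕ) (K : Fin 5 → Fin n → Matrix (Fin 3) (Fin 3) ℂ),
        (∀ x, ∑ α, (K x α)ᴴ * K x α = A x) ∧
        (∀ y, ∑ x, ∑ α, (K x α)ᴴ * B y * K x α = B y)) ∧
      ¬ (∃ (n : ℕ) (L : Fin 2 → Fin n → Matrix (Fin 3) (Fin 3) ℂ),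
        (∀ y, ∑ α, (L y α)ᴴ * L y α = B y) ∧
        (∀ x, ∑ y, ∑ α, (L y α)ᴴ * A x * L y α = A x)) := by
  refine ⟨coherentEffect, diagEffect, fun x => Matrix.posSemidef_conjTranspose_mul_self _,
    sum_coherentEffect, diagEffect_posSemidef, sum_diagEffect,
    ⟨1, fun x _ => coherentKraus x, fun x => by simp [coherentEffect], fun y => by
      simpa using coherentKraus_fixes_diagEffect y⟩, ?_⟩
  rintro ⟨n, L, hB, hA⟩
  let M : Fin 2 × Fin n → Matrix (Fin 3) (Fin 3) ℂ := fun p => L p.1 p.2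
  have hM : ∀ x, ∑ p, (M p)ᴴ * coherentEffect x * M p = coherentEffect x := fun x => by
    rw [Fintype.sum_prod_type]
    exact hA x
  have hspan : ∀ X, (∃ c : Fin 5 → ℂ, ∑ x, c x • coherentEffect x = X) →
      ∑ p, (M p)ᴴ * X * M p = X := by
    rintro _ ⟨c, rfl⟩
    simp only [Finset.mul_sum, Finset.sum_mul, Matrix.mul_smul, Matrix.smul_mul]
    rw [Finset.sum_comm]
    simp only [← Finset.smul_sum, hM]
  have hgram := kraus_gram_diag_eq M
    (fun k => hspan _ (single_diag_mem_span_coherentEffect k))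
    (hspan _ coherence_mem_span_coherentEffect)
  have h : diagEffect 0 0 0 = diagEffect 0 2 2 := by
    rw [← hB 0, Matrix.sum_apply, Matrix.sum_apply]
    exact Finset.sum_congr rfl fun α _ => hgram (0, α)
  have h2 : (![1, 0, 1 / 2] : Fin 3 → ℂ) 2 = 1 / 2 := rfl
  norm_num [diagEffect, h2] at h
end
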